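/- Let w > 0. The Hecke triangle group Γ_w is a discrete subgroup of SL(2,ℝ) (i.e., Γ_w with the subspace topology is a discrete topological space) if and only if w ≥ 2 or w = 2·cos(π/q) for some natural number q ≥ 3. -/

import Mathlib

open MeasureTheory

/-- `S = [[0,1],[-1,0]]` as an element of `SL(2,ℝ)`. -/
noncomputable def S : Matrix.SpecialLinearGroup (Fin 2) ℝ :=
  ⟨!![0, 1; -1, 0], by norm_num [Matrix.det_fin_two_of]⟩

/-- `T_w = [[1,w],[0,1]]` as an element of `SL(2,ℝ)`. -/
noncomputable def T (w : ℝ) : Matrix.SpecialLinearGroup (Fin 2) ℝ :=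
  ⟨!![1, w; 0, 1], by norm_num [Matrix.det_fin_two_of]⟩

/-- The Hecke triangle group `Γ_w`, the subgroup of `SL(2,ℝ)` generated by `S` and `T_w`. -/
noncomputable def heckeGroup (w : ℝ) : Subgroup (Matrix.SpecialLinearGroup (Fin 2) ℝ) :=
  Subgroup.closure {S, T w}


open Filter Topology
open Matrix (SpecialLinearGroup)

lemma coe_S : (S : Matrix (Fin 2) (Fin 2) ℝ) = !![0, 1; -1, 0] := rfl

lemma coe_T (w : ℝ) : (T w : Matrix (Fin 2) (Fin 2) ℝ) = !![1, w; 0, 1] := rfl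

/-- The product `T_w S⁻¹ = [[w,-1],[1,0]]`, which together with `S` generates `Γ_w`. -/
noncomputable def heckeU (w : ℝ) : SpecialLinearGroup (Fin 2) ℝ := T w * S⁻¹

lemma heckeU_mem (w : ℝ) : heckeU w ∈ heckeGroup w :=
  mul_mem (Subgroup.subset_closure (by simp)) (inv_mem (Subgroup.subset_closure (by simp)))

lemma coe_heckeU (w : ℝ) : (heckeU w : Matrix (Fin 2) (Fin 2) ℝ) = !![w, -1; 1, 0] := by
  simp [heckeU, coe_S, coe_T, Matrix.SpecialLinearGroup.coe_inv, Matrix.adjugate_fin_two]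

lemma S_mul_S : S * S = -1 := by
  ext i j
  fin_cases i <;> fin_cases j <;> simp [coe_S]

/-! ### Conjugating a parabolic element -/

/-- The sequence `A`, `A T_w A⁻¹`, … obtained by repeatedly conjugating `T_w`. -/
noncomputable def conjSeq (w : ℝ) (A : SpecialLinearGroup (Fin 2) ℝ) :
    ℕ → SpecialLinearGroup (Fin 2) ℝ
  | 0 => A
  | n + 1 => conjSeq w A n * T w * (conjSeq w A n)⁻¹

lemma coe_conj_T (w : ℝ) (A : SpecialLinearGroup (Fin 2) ℝ) :
    ((A * T w * A⁻¹ : SpecialLinearGroup (Fin 2) ℝ) : Matrix (Fin 2) (Fin 2) ℝ) =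
      !![1 - A 0 0 * (A 1 0 * w), w * A 0 0 ^ 2; -(A 1 0 * (A 1 0 * w)),
        1 + A 0 0 * (A 1 0 * w)] := by
  have hA : A 0 0 * A 1 1 - A 0 1 * A 1 0 = 1 := by
    rw [← Matrix.det_fin_two]; exact A.det_coe
  ext i j
  fin_cases i <;> fin_cases j <;>
    simp [coe_T, Matrix.SpecialLinearGroup.coe_inv, Matrix.adjugate_fin_two, Matrix.mul_apply,
      Fin.sum_univ_two] <;> first | ring1 | linear_combination hA

lemma lower_left_eq_zero_of_discrete {w : ℝ} (hw : 0 < w)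
    (G : Subgroup (SpecialLinearGroup (Fin 2) ℝ)) (hT : T w ∈ G)
    (hG : DiscreteTopology ↥((fun γ : SpecialLinearGroup (Fin 2) ℝ =>
      (γ : Matrix (Fin 2) (Fin 2) ℝ)) '' (G : Set (SpecialLinearGroup (Fin 2) ℝ))))
    {A : SpecialLinearGroup (Fin 2) ℝ} (hA : A ∈ G) (hlt : |A 1 0 * w| < 1) : A 1 0 = 0 := by
  by_contra hne
  set x := conjSeq w A with hx
  have hmem : ∀ n, x n ∈ G := by
    intro n
    induction n with
    | zero => exact hA
    | succ n ih => exact mul_mem (mul_mem ih hT) (inv_mem ih)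
  have hsucc : ∀ n, (x (n + 1) : Matrix (Fin 2) (Fin 2) ℝ) =
      !![1 - x n 0 0 * (x n 1 0 * w), w * x n 0 0 ^ 2; -(x n 1 0 * (x n 1 0 * w)),
        1 + x n 0 0 * (x n 1 0 * w)] := fun n => coe_conj_T w (x n)
  have hc_ne : ∀ n, x n 1 0 ≠ 0 := by
    intro n
    induction n with
    | zero => exact hne
    | succ n ih => rw [hsucc]; simp [ih, hw.ne']
  set ρ := |A 1 0 * w| with hρ
  have hρ0 : 0 ≤ ρ := abs_nonneg _
  have hu : ∀ n, |x n 1 0 * w| ≤ ρ ^ (n + 1) := by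
    intro n
    induction n with
    | zero => simp [hρ, hx, conjSeq]
    | succ n ih =>
      have h1 : x (n + 1) 1 0 * w = -((x n 1 0 * w) * (x n 1 0 * w)) := by
        rw [hsucc]; simp; ring
      rw [h1, abs_neg, abs_mul, pow_succ]
      have h2 : |x n 1 0 * w| ≤ ρ :=
        ih.trans (pow_le_of_le_one hρ0 hlt.le (Nat.succ_ne_zero n))
      exact mul_le_mul ih h2 (abs_nonneg _) (by positivity)
  obtain ⟨B, hB0, hB⟩ : ∃ B : ℝ, 0 ≤ B ∧ ∀ n, |x n 0 0| ≤ B := by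
    have h1 : 0 < 1 - ρ := by linarith
    set B := max |A 0 0| (1 / (1 - ρ)) with hBdef
    have hB1 : 1 ≤ B * (1 - ρ) := by
      rw [← div_le_iff₀ h1]; exact le_max_right _ _
    have hB0 : 0 ≤ B := (abs_nonneg _).trans (le_max_left _ _)
    refine ⟨B, hB0, fun n => ?_⟩
    induction n with
    | zero => exact le_max_left _ _
    | succ n ih =>
      have h2 : x (n + 1) 0 0 = 1 - x n 0 0 * (x n 1 0 * w) := by rw [hsucc]; simp
      have h3 : |x n 1 0 * w| ≤ ρ :=
        (hu n).trans (pow_le_of_le_one hρ0 hlt.le (Nat.succ_ne_zero n))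
      have h4 : |x n 0 0 * (x n 1 0 * w)| ≤ B * ρ := by
        rw [abs_mul]; exact mul_le_mul ih h3 (abs_nonneg _) hB0
      rw [h2]
      have h5 := abs_sub (1 : ℝ) (x n 0 0 * (x n 1 0 * w))
      rw [abs_one] at h5
      linarith
  have hpow : Tendsto (fun n : ℕ => ρ ^ (n + 1)) atTop (𝓝 0) :=
    (tendsto_pow_atTop_nhds_zero_of_lt_one hρ0 hlt).comp (tendsto_add_atTop_nat 1)
  have hu0 : Tendsto (fun n => x n 1 0 * w) atTop (𝓝 0) :=
    squeeze_zero_norm hu hpow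
  have hau : Tendsto (fun n => x n 0 0 * (x n 1 0 * w)) atTop (𝓝 0) := by
    refine squeeze_zero_norm (a := fun n => B * ρ ^ (n + 1)) (fun n => ?_)
      (by simpa using hpow.const_mul B)
    rw [Real.norm_eq_abs, abs_mul]
    exact mul_le_mul (hB n) (hu n) (abs_nonneg _) hB0
  have hc : Tendsto (fun n => x n 1 0) atTop (𝓝 0) := by
    simpa [hw.ne'] using hu0.div_const w
  have ha : Tendsto (fun n => x n 0 0) atTop (𝓝 1) := by
    rw [← tendsto_add_atTop_iff_nat 1]
    simpa [hsucc] using hau.const_sub 1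
  have hlim : Tendsto (fun n => (x (n + 1) : Matrix (Fin 2) (Fin 2) ℝ)) atTop
      (𝓝 (T w : Matrix (Fin 2) (Fin 2) ℝ)) := by
    refine tendsto_pi_nhds.2 fun i => tendsto_pi_nhds.2 fun j => ?_
    simp only [hsucc]
    fin_cases i <;> fin_cases j
    · simpa [coe_T] using hau.const_sub 1
    · simpa [coe_T] using (ha.pow 2).const_mul w
    · simpa [coe_T] using (hc.mul hu0).neg
    · simpa [coe_T] using hau.const_add 1
  have hlim' : Tendsto (fun n => (⟨x (n + 1), x (n + 1), hmem _, rfl⟩ :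
      ↥((fun γ : SpecialLinearGroup (Fin 2) ℝ =>
      (γ : Matrix (Fin 2) (Fin 2) ℝ)) '' (G : Set (SpecialLinearGroup (Fin 2) ℝ))))) atTop
      (𝓝 ⟨T w, T w, hT, rfl⟩) := tendsto_subtype_rng.2 hlim
  rw [nhds_discrete, tendsto_pure] at hlim'
  obtain ⟨n, hn⟩ := hlim'.exists
  have h := congrArg (fun M : Matrix (Fin 2) (Fin 2) ℝ => M 1 0) (congrArg Subtype.val hn)
  exact hc_ne (n + 1) (by simpa [coe_T] using h)

/-! ### Powers of the elliptic generator -/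

lemma coe_heckeU_pow {θ : ℝ} (hθ : Real.sin θ ≠ 0) (n : ℕ) :
    ((heckeU (2 * Real.cos θ) ^ n : SpecialLinearGroup (Fin 2) ℝ) : Matrix (Fin 2) (Fin 2) ℝ) =
      !![Real.sin ((n + 1) * θ) / Real.sin θ, -(Real.sin (n * θ) / Real.sin θ);
        Real.sin (n * θ) / Real.sin θ, -(Real.sin ((n - 1) * θ) / Real.sin θ)] := by
  have key : ∀ t : ℝ, 2 * Real.cos θ * Real.sin (t * θ) - Real.sin ((t - 1) * θ) =
      Real.sin ((t + 1) * θ) := by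
    intro t
    rw [add_mul, sub_mul, one_mul, Real.sin_add, Real.sin_sub]
    ring
  induction n with
  | zero =>
    ext i j
    fin_cases i <;> fin_cases j <;> simp [hθ]
  | succ n ih =>
    have h1 := key (n + 1)
    have h0 := key n
    rw [add_sub_cancel_right] at h1
    rw [pow_succ', Matrix.SpecialLinearGroup.coe_mul, ih, coe_heckeU]
    push_cast
    rw [add_sub_cancel_right, ← h1, ← h0]
    ext i j
    fin_cases i <;> fin_cases j <;> simp [Matrix.mul_apply, Fin.sum_univ_two] <;> ring

lemma eq_cos_pi_div_of_discrete {w : ℝ} (hw : 0 < w) (hw2 : w < 2)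
    (hG : DiscreteTopology ↥((fun γ : SpecialLinearGroup (Fin 2) ℝ =>
      (γ : Matrix (Fin 2) (Fin 2) ℝ)) '' (heckeGroup w : Set (SpecialLinearGroup (Fin 2) ℝ)))) :
    ∃ q : ℕ, 3 ≤ q ∧ w = 2 * Real.cos (Real.pi / q) := by
  obtain ⟨θ, hθ0, hθ1, rfl⟩ : ∃ θ : ℝ, 0 < θ ∧ θ < Real.pi / 2 ∧ w = 2 * Real.cos θ := by
    refine ⟨Real.arccos (w / 2), Real.arccos_pos.2 (by linarith),
      Real.arccos_lt_pi_div_two.2 (by linarith), ?_⟩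
    rw [Real.cos_arccos (by linarith) (by linarith)]
    ring
  have hpi := Real.pi_pos
  set n := ⌊Real.pi / θ⌋₊ with hn
  have hn1 : n * θ ≤ Real.pi := by
    rw [← le_div_iff₀ hθ0]; exact Nat.floor_le (by positivity)
  have hn2 : Real.pi < (n + 1) * θ := by
    rw [← div_lt_iff₀ hθ0]; exact Nat.lt_floor_add_one _
  have hsin : 0 < Real.sin θ := Real.sin_pos_of_pos_of_lt_pi hθ0 (by linarith)
  rcases hn1.eq_or_lt with heq | hlt
  · have hnpos : (n : ℝ) ≠ 0 := by
      intro h; rw [h] at heq; linarith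
    refine ⟨n, ?_, ?_⟩
    · by_contra! h
      have : (n : ℝ) ≤ 2 := by exact_mod_cast Nat.lt_succ_iff.1 h
      nlinarith
    · rw [← heq, mul_div_cancel_left₀ _ hnpos]
  exfalso
  obtain ⟨k, hk0, hk1⟩ : ∃ k : ℕ, 0 < |Real.sin (k * θ)| ∧
      |Real.sin (k * θ)| ≤ Real.sin (θ / 2) := by
    have aux : ∀ y, 0 < y → y ≤ θ / 2 → 0 < |Real.sin y| ∧ |Real.sin y| ≤ Real.sin (θ / 2) := by
      intro y hy0 hy1
      have h := Real.sin_pos_of_pos_of_lt_pi hy0 (by linarith)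
      rw [abs_of_pos h]
      exact ⟨h, Real.sin_le_sin_of_le_of_le_pi_div_two (by linarith) (by linarith) hy1⟩
    rcases le_total (Real.pi - n * θ) (θ / 2) with h | h
    · refine ⟨n, ?_⟩
      rw [← Real.sin_pi_sub]
      exact aux _ (by linarith) h
    · refine ⟨n + 1, ?_⟩
      push_cast
      rw [← abs_neg, ← Real.sin_sub_pi]
      exact aux _ (by linarith) (by linarith)
  have hpow := coe_heckeU_pow hsin.ne' k
  have hentry : (heckeU (2 * Real.cos θ) ^ k) 1 0 = Real.sin (k * θ) / Real.sin θ := by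
    rw [hpow]; simp
  have hzero := lower_left_eq_zero_of_discrete hw (heckeGroup (2 * Real.cos θ))
    (Subgroup.subset_closure (by simp)) hG (pow_mem (heckeU_mem _) k) (by
      rw [hentry, abs_mul, abs_div, abs_of_pos hsin, abs_of_pos hw, div_mul_eq_mul_div,
        div_lt_one hsin]
      have hs2 : 0 < Real.sin (θ / 2) := Real.sin_pos_of_pos_of_lt_pi (by linarith) (by linarith)
      have hcos : Real.cos θ < Real.cos (θ / 2) :=
        Real.cos_lt_cos_of_nonneg_of_le_pi_div_two (by linarith) hθ1.le (by linarith)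
      have hdouble : Real.sin θ = 2 * Real.sin (θ / 2) * Real.cos (θ / 2) := by
        rw [← Real.sin_two_mul]; congr 1; ring
      rw [hdouble]
      nlinarith [mul_le_mul_of_nonneg_right hk1 hw.le, mul_lt_mul_of_pos_left hcos hs2])
  rw [hentry, div_eq_zero_iff] at hzero
  rcases hzero with h | h
  · rw [h, abs_zero] at hk0; exact hk0.false
  · exact hsin.ne' h

/-! ### Normal forms and discreteness -/

/-- Nonnegative matrices with diagonal at least `1` and some off-diagonal entry at least `1`. -/
def IsExpanding (A : SpecialLinearGroup (Fin 2) ℝ) : Prop :=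
  1 ≤ A 0 0 ∧ 0 ≤ A 0 1 ∧ 0 ≤ A 1 0 ∧ 1 ≤ A 1 1 ∧ (1 ≤ A 0 1 ∨ 1 ≤ A 1 0)

lemma IsExpanding.mul {A B : SpecialLinearGroup (Fin 2) ℝ} (hA : IsExpanding A)
    (hB : IsExpanding B) : IsExpanding (A * B) := by
  obtain ⟨a1, a2, a3, a4, a5⟩ := hA
  obtain ⟨b1, b2, b3, b4, -⟩ := hB
  simp only [IsExpanding, Matrix.SpecialLinearGroup.coe_mul, Matrix.mul_apply, Fin.sum_univ_two]
  refine ⟨by nlinarith [mul_nonneg a2 b3], by nlinarith [mul_nonneg a2 (zero_le_one.trans b4)],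
    by nlinarith [mul_nonneg a3 (zero_le_one.trans b1)], by nlinarith [mul_nonneg a3 b2], ?_⟩
  rcases a5 with h | h
  · left; nlinarith
  · right; nlinarith

/-- The expanding matrices of the form `± U^k S`. -/
def heckeLetters (w : ℝ) : Set (SpecialLinearGroup (Fin 2) ℝ) :=
  {V | IsExpanding V ∧ ∃ i k : ℤ, V = S ^ (2 * i) * heckeU w ^ k * S}

/-- The matrices `S^i M S^j` with `M` a product of letters. -/
def heckeWords (w : ℝ) : Set (SpecialLinearGroup (Fin 2) ℝ) :=
  {g | ∃ M ∈ Submonoid.closure (heckeLetters w), ∃ i j : ℤ, g = S ^ i * M * S ^ j}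

lemma commute_S_zpow_two_mul (i : ℤ) (A : SpecialLinearGroup (Fin 2) ℝ) :
    Commute (S ^ (2 * i)) A := by
  rw [zpow_mul, zpow_two, S_mul_S]
  exact (Commute.neg_one_left A).zpow_left i

/-- Every power of `U` is `±1` or becomes expanding, up to sign, after multiplication by `S`. -/
def HasExpandingPowers (w : ℝ) : Prop :=
  ∀ k : ℤ, (∃ i : ℤ, heckeU w ^ k = S ^ (2 * i)) ∨
    ∃ i : ℤ, IsExpanding (S ^ (2 * i) * heckeU w ^ k * S)

lemma mul_heckeU_zpow_mem_heckeWords {w : ℝ} (H : HasExpandingPowers w)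
    {M : SpecialLinearGroup (Fin 2) ℝ} (hM : M ∈ Submonoid.closure (heckeLetters w)) (i k : ℤ) :
    S ^ i * M * heckeU w ^ k ∈ heckeWords w := by
  rcases H k with ⟨l, hl⟩ | ⟨l, hl⟩
  · exact ⟨M, hM, i, 2 * l, by rw [hl]⟩
  · refine ⟨M * (S ^ (2 * l) * heckeU w ^ k * S),
      mul_mem hM (Submonoid.subset_closure ⟨hl, l, k, rfl⟩), i - 2 * l, -1, ?_⟩
    have h := (commute_S_zpow_two_mul l M).eq
    rw [zpow_sub, zpow_neg_one]
    calc S ^ i * M * heckeU w ^ k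
        = S ^ i * (S ^ (2 * l))⁻¹ * (S ^ (2 * l) * M) * heckeU w ^ k := by group
      _ = _ := by rw [h]; group

lemma eq_one_or_eq_mul_letter {w : ℝ} {M : SpecialLinearGroup (Fin 2) ℝ}
    (hM : M ∈ Submonoid.closure (heckeLetters w)) :
    M = 1 ∨ ∃ M' ∈ Submonoid.closure (heckeLetters w), ∃ V ∈ heckeLetters w, M = M' * V := by
  induction hM using Submonoid.closure_induction_right with
  | one => exact Or.inl rfl
  | mul_right x hx y hy _ => exact Or.inr ⟨x, hx, y, hy, rfl⟩

lemma heckeWords_mul_heckeU_zpow {w : ℝ} (H : HasExpandingPowers w)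
    {g : SpecialLinearGroup (Fin 2) ℝ} (hg : g ∈ heckeWords w) (k : ℤ) :
    g * heckeU w ^ k ∈ heckeWords w := by
  obtain ⟨M, hM, i, j, rfl⟩ := hg
  rcases Int.even_or_odd' j with ⟨l, rfl | rfl⟩
  · rw [mul_assoc (S ^ i), ← (commute_S_zpow_two_mul l M).eq, ← mul_assoc, ← zpow_add]
    exact mul_heckeU_zpow_mem_heckeWords H hM _ k
  rcases eq_one_or_eq_mul_letter hM with rfl | ⟨M', hM', V, ⟨-, m, p, rfl⟩, rfl⟩
  · rw [mul_one, ← zpow_add, ← mul_one (S ^ _)]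
    exact mul_heckeU_zpow_mem_heckeWords H (one_mem _) _ k
  · have h := mul_heckeU_zpow_mem_heckeWords H hM' (i + 2 * (m + l + 1)) (p + k)
    convert h using 1
    have h1 := (commute_S_zpow_two_mul m M').eq
    have h2 := (commute_S_zpow_two_mul (l + 1) (M' * heckeU w ^ p)).eq
    calc S ^ i * (M' * (S ^ (2 * m) * heckeU w ^ p * S)) * S ^ (2 * l + 1) * heckeU w ^ k
        = S ^ i * (M' * S ^ (2 * m)) * heckeU w ^ p * S ^ (2 * (l + 1)) * heckeU w ^ k := by
          group
      _ = S ^ i * S ^ (2 * m) * (M' * heckeU w ^ p * S ^ (2 * (l + 1))) * heckeU w ^ k := by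
          rw [← h1]; group
      _ = _ := by rw [← h2]; group

lemma heckeGroup_subset_heckeWords {w : ℝ} (H : HasExpandingPowers w) :
    (heckeGroup w : Set (SpecialLinearGroup (Fin 2) ℝ)) ⊆ heckeWords w := by
  have hS : ∀ g ∈ heckeWords w, ∀ k : ℤ, g * S ^ k ∈ heckeWords w := by
    rintro g ⟨M, hM, i, j, rfl⟩ k
    exact ⟨M, hM, i, j + k, by rw [zpow_add, ← mul_assoc]⟩
  have hT : T w = heckeU w ^ (1 : ℤ) * S ^ (1 : ℤ) := by simp [heckeU]
  intro g hg
  induction hg using Subgroup.closure_induction_right with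
  | one => exact ⟨1, one_mem _, 0, 0, by simp⟩
  | mul_right x _ y hy ih =>
    rcases hy with rfl | rfl
    · simpa using hS x ih 1
    · rw [hT, ← mul_assoc]
      exact hS _ (heckeWords_mul_heckeU_zpow H ih 1) 1
  | mul_inv_cancel x _ y hy ih =>
    rcases hy with rfl | rfl
    · simpa using hS x ih (-1)
    · rw [hT, _root_.mul_inv_rev, ← zpow_neg, ← zpow_neg, ← mul_assoc]
      exact heckeWords_mul_heckeU_zpow H (hS _ ih _) _

lemma S_zpow_two_mul (i : ℤ) : S ^ (2 * i) = 1 ∨ S ^ (2 * i) = -1 := by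
  rw [zpow_mul, zpow_two, S_mul_S]
  rcases Int.even_or_odd i with h | h
  · exact Or.inl h.neg_one_zpow
  · exact Or.inr h.neg_one_zpow

lemma S_zpow (i : ℤ) : S ^ i = 1 ∨ S ^ i = -1 ∨ S ^ i = S ∨ S ^ i = -S := by
  rcases Int.even_or_odd' i with ⟨l, rfl | rfl⟩
  · rcases S_zpow_two_mul l with h | h <;> simp [h]
  · rcases S_zpow_two_mul l with h | h <;> simp [h, zpow_add]

lemma eq_one_or_isExpanding_of_mem_closure {w : ℝ} {M : SpecialLinearGroup (Fin 2) ℝ}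
    (hM : M ∈ Submonoid.closure (heckeLetters w)) : M = 1 ∨ IsExpanding M := by
  induction hM using Submonoid.closure_induction with
  | mem x hx => exact Or.inr hx.1
  | one => exact Or.inl rfl
  | mul x y _ _ hx hy =>
    rcases hx with rfl | hx
    · simpa using hy
    · rcases hy with rfl | hy
      · simpa using Or.inr hx
      · exact Or.inr (hx.mul hy)

lemma eq_one_or_eq_neg_one_or_one_le_abs {w : ℝ} {g : SpecialLinearGroup (Fin 2) ℝ}
    (hg : g ∈ heckeWords w) : g = 1 ∨ g = -1 ∨ 1 ≤ |g 0 1| ∨ 1 ≤ |g 1 0| := by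
  obtain ⟨M, hM, i, j, rfl⟩ := hg
  rcases eq_one_or_isExpanding_of_mem_closure hM with rfl | ⟨h1, -, -, h4, h5⟩
  · rw [mul_one, ← zpow_add]
    rcases S_zpow (i + j) with h | h | h | h <;> simp [h, coe_S]
  · right; right
    have h1' := h1.trans (le_abs_self _)
    have h4' := h4.trans (le_abs_self _)
    have h5' := h5.imp (fun h => h.trans (le_abs_self _)) (fun h => h.trans (le_abs_self _))
    rcases S_zpow i with h | h | h | h <;> rcases S_zpow j with h' | h' | h' | h' <;>
      simp [h, h', coe_S, Matrix.mul_apply, Matrix.vecMul, dotProduct, Fin.sum_univ_two, h1',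
        h4', h5', h5'.symm]

lemma discreteTopology_of_isolated_one (G : Subgroup (SpecialLinearGroup (Fin 2) ℝ))
    (hG : ∀ g ∈ G, g = 1 ∨ g = -1 ∨ 1 ≤ |g 0 1| ∨ 1 ≤ |g 1 0|) :
    DiscreteTopology ↥((fun γ : SpecialLinearGroup (Fin 2) ℝ =>
      (γ : Matrix (Fin 2) (Fin 2) ℝ)) '' (G : Set (SpecialLinearGroup (Fin 2) ℝ))) := by
  rw [discreteTopology_iff_isOpen_singleton]
  rintro ⟨_, γ, hγ, rfl⟩
  let f : Matrix (Fin 2) (Fin 2) ℝ → Matrix (Fin 2) (Fin 2) ℝ := fun X =>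
    ((γ⁻¹ : SpecialLinearGroup (Fin 2) ℝ) : Matrix (Fin 2) (Fin 2) ℝ) * X
  have hf : Continuous f := continuous_const.matrix_mul continuous_id
  refine isOpen_induced_iff.2 ⟨{X | |f X 0 1| < 1 ∧ |f X 1 0| < 1 ∧ 0 < f X 0 0}, ?_, ?_⟩
  · exact (isOpen_lt (hf.matrix_elem 0 1).abs continuous_const).and
      ((isOpen_lt (hf.matrix_elem 1 0).abs continuous_const).and
        (isOpen_lt continuous_const (hf.matrix_elem 0 0)))
  · ext ⟨_, δ, hδ, rfl⟩
    have hfδ : f δ = ((γ⁻¹ * δ : SpecialLinearGroup (Fin 2) ℝ) : Matrix (Fin 2) (Fin 2) ℝ) := by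
      simp [f]
    rw [Set.mem_preimage, Set.mem_ofPred_eq, Set.mem_singleton_iff, hfδ]
    constructor
    · rintro ⟨h1, h2, h3⟩
      rcases hG _ (mul_mem (inv_mem hγ) hδ) with h | h | h | h
      · exact Subtype.ext (congrArg (fun A : SpecialLinearGroup (Fin 2) ℝ =>
          (A : Matrix (Fin 2) (Fin 2) ℝ)) (inv_mul_eq_one.1 h).symm)
      · rw [h] at h3; norm_num at h3
      · exact absurd h1 h.not_gt
      · exact absurd h2 h.not_gt
    · intro h
      rw [show δ = γ from Subtype.ext (Subtype.mk.inj h), inv_mul_cancel]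
      simp

/-! ### Verifying the expansion property -/

lemma isExpanding_of_coe_heckeU_pow {w p r t : ℝ} {n : ℤ}
    (h : ((heckeU w ^ n : SpecialLinearGroup (Fin 2) ℝ) : Matrix (Fin 2) (Fin 2) ℝ) =
      !![p, -r; r, -t]) (hr : 1 ≤ r) (hp : 0 ≤ p) (ht : 0 ≤ t) (hpt : 1 ≤ p ∨ 1 ≤ t) :
    IsExpanding (heckeU w ^ n * S) := by
  simp [IsExpanding, coe_S, Matrix.mul_apply, Fin.sum_univ_two, *]

lemma hasExpandingPowers_of_two_le {w : ℝ} (hw : 2 ≤ w) : HasExpandingPowers w := by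
  have hpow : ∀ n : ℕ, ∃ p r t : ℝ, ((heckeU w ^ n : SpecialLinearGroup (Fin 2) ℝ) :
      Matrix (Fin 2) (Fin 2) ℝ) = !![p, -r; r, -t] ∧ r + 1 ≤ p ∧ t + 1 ≤ r ∧ (n : ℝ) - 1 ≤ t := by
    intro n
    induction n with
    | zero =>
      refine ⟨1, 0, -1, ?_, by norm_num, by norm_num, by norm_num⟩
      ext i j
      fin_cases i <;> fin_cases j <;> simp
    | succ n ih =>
      obtain ⟨p, r, t, h, h1, h2, h3⟩ := ih
      have hn : (0 : ℝ) ≤ n := n.cast_nonneg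
      refine ⟨w * p - r, p, r, ?_, by nlinarith, h1, by push_cast; linarith⟩
      have hleft : ((heckeU w ^ (n + 1) : SpecialLinearGroup (Fin 2) ℝ) :
          Matrix (Fin 2) (Fin 2) ℝ) = !![w * p - r, -(w * r - t); p, -r] := by
        rw [pow_succ', Matrix.SpecialLinearGroup.coe_mul, h, coe_heckeU]
        ext i j
        fin_cases i <;> fin_cases j <;> simp [Matrix.mul_apply, Fin.sum_univ_two] <;> ring
      have hright : ((heckeU w ^ (n + 1) : SpecialLinearGroup (Fin 2) ℝ) :
          Matrix (Fin 2) (Fin 2) ℝ) = !![p * w - r, -p; r * w - t, -r] := by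
        rw [pow_succ, Matrix.SpecialLinearGroup.coe_mul, h, coe_heckeU]
        ext i j
        fin_cases i <;> fin_cases j <;> simp [Matrix.mul_apply, Fin.sum_univ_two] <;> ring
      have hentry := congrArg (fun M : Matrix (Fin 2) (Fin 2) ℝ => M 1 0) (hleft.symm.trans hright)
      simp at hentry
      rw [hleft, hentry]
      congr! 5
      linarith
  intro k
  rcases Int.eq_nat_or_neg k with ⟨n, rfl | rfl⟩
  all_goals
    rcases Nat.eq_zero_or_pos n with rfl | hn
    · exact Or.inl ⟨0, by simp⟩
    right
    obtain ⟨p, r, t, h, h1, h2, h3⟩ := hpow n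
    have hn1 : (1 : ℝ) ≤ n := by exact_mod_cast hn
  · refine ⟨0, ?_⟩
    rw [mul_zero, zpow_zero, one_mul]
    exact isExpanding_of_coe_heckeU_pow (by simpa using h) (by linarith) (by linarith)
      (by linarith) (Or.inl (by linarith))
  · refine ⟨1, ?_⟩
    rw [mul_one, zpow_two, S_mul_S, zpow_neg, zpow_natCast]
    have hp : 1 ≤ p := by linarith
    have hr : 1 ≤ r := by linarith
    have ht : 0 ≤ t := by linarith
    have hp' : 0 ≤ p := by linarith
    simp [IsExpanding, Matrix.SpecialLinearGroup.coe_inv, h, coe_S, Matrix.adjugate_fin_two,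
      hp, hr, ht, hp']

lemma sin_le_sin_of_le_of_le_pi_sub {θ x : ℝ} (h0 : 0 ≤ θ) (h1 : θ ≤ x) (h2 : x ≤ Real.pi - θ) :
    Real.sin θ ≤ Real.sin x := by
  rw [← sub_nonneg, Real.sin_sub_sin]
  have hs := Real.sin_nonneg_of_nonneg_of_le_pi (x := (x - θ) / 2) (by linarith) (by linarith)
  have hc := Real.cos_nonneg_of_neg_pi_div_two_le_of_le (x := (x + θ) / 2) (by linarith)
    (by linarith)
  positivity

lemma hasExpandingPowers_cos_pi_div {q : ℕ} (hq : 3 ≤ q) :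
    HasExpandingPowers (2 * Real.cos (Real.pi / q)) := by
  have hq' : (3 : ℝ) ≤ q := by exact_mod_cast hq
  have hpi := Real.pi_pos
  set θ := Real.pi / q with hθ
  have hqθ : q * θ = Real.pi := by rw [hθ]; field_simp
  have hθ0 : 0 < θ := by positivity
  have hsin : 0 < Real.sin θ := Real.sin_pos_of_pos_of_lt_pi hθ0 (by nlinarith)
  have hle : ∀ t : ℝ, 1 ≤ t → t ≤ q - 1 → 1 ≤ Real.sin (t * θ) / Real.sin θ := by
    intro t h1 h2
    rw [one_le_div hsin]
    exact sin_le_sin_of_le_of_le_pi_sub hθ0.le (by nlinarith) (by nlinarith)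
  have hnonneg : ∀ t : ℝ, 0 ≤ t → t ≤ q → 0 ≤ Real.sin (t * θ) / Real.sin θ := by
    intro t h1 h2
    exact div_nonneg (Real.sin_nonneg_of_nonneg_of_le_pi (by positivity) (by nlinarith)) hsin.le
  have hUq : heckeU (2 * Real.cos θ) ^ q = S ^ (2 * 1 : ℤ) := by
    rw [mul_one, zpow_two, S_mul_S]
    apply Subtype.ext
    rw [coe_heckeU_pow hsin.ne', add_mul, sub_mul, one_mul, hqθ]
    ext i j
    fin_cases i <;> fin_cases j <;> simp [Real.sin_pi_sub, add_comm Real.pi, hsin.ne']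
  intro k
  have hk : heckeU (2 * Real.cos θ) ^ k =
      S ^ (2 * (k / q)) * heckeU (2 * Real.cos θ) ^ (k % q).toNat := by
    rw [← zpow_natCast (heckeU _), Int.toNat_of_nonneg (Int.emod_nonneg _ (by omega))]
    nth_rw 1 [← Int.mul_ediv_add_emod k q]
    rw [zpow_add, zpow_mul, zpow_natCast, hUq, ← zpow_mul, mul_one]
  set r := (k % q).toNat with hr
  have hrq : r < q := by
    have := Int.emod_lt_of_pos k (b := q) (by omega)
    omega
  rcases Nat.eq_zero_or_pos r with h0 | hpos
  · left
    exact ⟨k / q, by rw [hk, h0, pow_zero, mul_one]⟩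
  · right
    refine ⟨-(k / q), ?_⟩
    rw [hk, ← mul_assoc, ← zpow_add, show 2 * -(k / q) + 2 * (k / q) = 0 by ring, zpow_zero,
      one_mul, ← zpow_natCast]
    have hr1 : (1 : ℝ) ≤ r := by exact_mod_cast hpos
    have hr2 : (r : ℝ) + 1 ≤ q := by exact_mod_cast hrq
    refine isExpanding_of_coe_heckeU_pow (by rw [zpow_natCast]; exact coe_heckeU_pow hsin.ne' r)
      (hle _ hr1 (by linarith)) (hnonneg _ (by linarith) hr2)
      (hnonneg _ (by linarith) (by linarith)) ?_
    rcases Nat.lt_or_ge (r + 1) q with h | h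
    · left
      have : (r : ℝ) + 2 ≤ q := by exact_mod_cast h
      exact hle _ (by linarith) (by linarith)
    · right
      have : (q : ℝ) ≤ r + 1 := by exact_mod_cast h
      exact hle _ (by linarith) (by linarith)

theorem hecke_discrete_iff (w : ℝ) (hw : 0 < w) :
    DiscreteTopology ↥((fun γ : Matrix.SpecialLinearGroup (Fin 2) ℝ =>
        (γ : Matrix (Fin 2) (Fin 2) ℝ)) ''
        (heckeGroup w : Set (Matrix.SpecialLinearGroup (Fin 2) ℝ))) ↔
      (2 ≤ w ∨ ∃ q : ℕ, 3 ≤ q ∧ w = 2 * Real.cos (Real.pi / q)) := by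
  constructor
  · intro hG
    rcases le_or_gt 2 w with h | h
    · exact Or.inl h
    · exact Or.inr (eq_cos_pi_div_of_discrete hw h hG)
  · intro h
    have H : HasExpandingPowers w := by
      rcases h with h | ⟨q, hq, rfl⟩
      · exact hasExpandingPowers_of_two_le h
      · exact hasExpandingPowers_cos_pi_div hq
    exact discreteTopology_of_isolated_one _ fun g hg =>
      eq_one_or_eq_neg_one_or_one_le_abs (heckeGroup_subset_heckeWords H hg)
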